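/- arXiv:math/0403406 — 3 statements merged into one kernel-verified Lean document; each statement's English description precedes it below -/
import Mathlib

section
/- Let h be a fixed-point-free orientation-preserving homeomorphism of the plane, and let D be a closed topological disk that is free (i.e. h(D) ∩ D = ∅). Then for every nonzero integer n, D is disjoint from the interior of h^n(D). -/
open Set Filter Topology

/-- The plane. -/
abbrev Plane : Type := ℝ × ℝ

/-- A homeomorphism of the plane preserves orientation iff it is isotopic to the identity. -/
def IsotopicToId (h : Plane ≃ₜ Plane) : Prop :=
  ∃ H : ℝ → Plane ≃ₜ Plane,
    Continuous (fun p : ℝ × Plane => H p.1 p.2) ∧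
    H 0 = Homeomorph.refl Plane ∧ H 1 = h

/-- A Brouwer homeomorphism: an orientation-preserving (i.e. isotopic to the identity),
fixed-point-free homeomorphism of the plane. -/
structure BrouwerHomeo where
  toHomeomorph : Plane ≃ₜ Plane
  orientationPreserving : IsotopicToId toHomeomorph
  fixedPointFree : ∀ x : Plane, toHomeomorph x ≠ x

/-- The integer iterate `h^n`. -/
def BrouwerHomeo.iter (h : BrouwerHomeo) (n : ℤ) : Plane → Plane :=
  ⇑(h.toHomeomorph.toEquiv ^ n)

/-- A set is free if it is disjoint from its image under `h`. -/
def IsFree (h : BrouwerHomeo) (E : Set Plane) : Prop :=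
  Disjoint (h.toHomeomorph '' E) E

/-- A closed topological disk: a subset of the plane homeomorphic to the closed unit disk. -/
def IsClosedDisk (D : Set Plane) : Prop :=
  Nonempty (D ≃ₜ (Metric.closedBall (0 : Plane) 1 : Set Plane))

section Isotopies

theorem IsotopicToId.refl : IsotopicToId (Homeomorph.refl Plane) :=
  ⟨fun _ => Homeomorph.refl Plane, continuous_snd, rfl, rfl⟩

theorem IsotopicToId.trans {f g : Plane ≃ₜ Plane} (hf : IsotopicToId f) (hg : IsotopicToId g) :
    IsotopicToId (f.trans g) := by
  obtain ⟨F, hF, hF0, hF1⟩ := hf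
  obtain ⟨G, hG, hG0, hG1⟩ := hg
  refine ⟨fun t => (F t).trans (G t), ?_, ?_, ?_⟩
  · exact hG.comp (continuous_fst.prodMk hF)
  · simp only [hF0, hG0]; rfl
  · simp only [hF1, hG1]

/-- A perturbation of the identity by a map with Lipschitz constant less than one is a
homeomorphism. -/
theorem exists_homeomorph_add_of_lipschitzWith {u : Plane → Plane} {c : NNReal} (hc : c < 1)
    (hu : LipschitzWith c u) : ∃ φ : Plane ≃ₜ Plane, ∀ x, φ x = x + u x := by
  have happ : ApproximatesLinearOn (fun x => x + u x)
      ((ContinuousLinearEquiv.refl ℝ Plane : Plane ≃L[ℝ] Plane) : Plane →L[ℝ] Plane) univ c := by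
    intro x _ y _
    have := hu.norm_sub_le x y
    have he : x + u x - (y + u y) - (x - y) = u x - u y := by abel
    simpa [he] using this
  refine ⟨happ.toHomeomorph _ (Or.inr ?_), fun x => rfl⟩
  have h1 : ‖((ContinuousLinearEquiv.refl ℝ Plane).symm : Plane →L[ℝ] Plane)‖₊ = 1 :=
    ContinuousLinearMap.nnnorm_id
  rw [h1]
  simpa using hc

theorem exists_isotopicToId_move_of_ball {a b : Plane} {r : ℝ} (hb : b ∈ Metric.ball a r) :
    ∃ φ : Plane ≃ₜ Plane, IsotopicToId φ ∧ (∀ x ∉ Metric.ball a r, φ x = x) ∧ φ a = b := by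
  rw [Metric.mem_ball, dist_eq_norm] at hb
  have hr : 0 < r := (norm_nonneg _).trans_lt hb
  set v : Plane := r⁻¹ • (b - a) with hv
  have hv1 : ‖v‖ < 1 := by
    rw [hv, norm_smul, norm_inv, Real.norm_of_nonneg hr.le, inv_mul_lt_one₀ hr]
    exact hb
  let s : ℝ → ℝ := fun t => max 0 (min 1 t)
  have hs0 : ∀ t, 0 ≤ s t := fun t => le_max_left _ _
  have hs1 : ∀ t, s t ≤ 1 := fun t => max_le zero_le_one (min_le_left _ _)
  let ρ : Plane → ℝ := fun x => max 0 (r - dist x a)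
  have hρ : LipschitzWith 1 ρ := by
    refine LipschitzWith.of_dist_le_mul fun x y => ?_
    have h1 : |max 0 (r - dist x a) - max 0 (r - dist y a)| ≤ |(r - dist x a) - (r - dist y a)| := by
      simpa [max_comm] using abs_max_sub_max_le_abs (r - dist x a) (r - dist y a) 0
    have h2 : |(r - dist x a) - (r - dist y a)| ≤ dist x y := by
      rw [sub_sub_sub_cancel_left, abs_sub_comm]
      exact abs_dist_sub_le x y a
    simpa [ρ, Real.dist_eq] using h1.trans h2
  have hu : ∀ t, LipschitzWith ‖v‖₊ (fun x => (s t * ρ x) • v) := by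
    intro t
    refine LipschitzWith.of_dist_le_mul fun x y => ?_
    have h1 := hρ.dist_le_mul x y
    rw [Real.dist_eq] at h1
    rw [dist_eq_norm, ← sub_smul, norm_smul, ← mul_sub, norm_mul, Real.norm_of_nonneg (hs0 t),
      Real.norm_eq_abs, mul_comm, coe_nnnorm]
    gcongr
    simp only [NNReal.coe_one, one_mul] at h1
    nlinarith [hs0 t, hs1 t, abs_nonneg (ρ x - ρ y)]
  choose H hH using fun t => exists_homeomorph_add_of_lipschitzWith
    (show ‖v‖₊ < 1 from hv1) (hu t)
  refine ⟨H 1, ⟨H, ?_, ?_, rfl⟩, fun x hx => ?_, ?_⟩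
  · simp only [hH, s, ρ]
    fun_prop
  · ext1 x
    simp [hH, s]
  · rw [Metric.mem_ball, not_lt] at hx
    simp [hH, ρ, hx]
  · simp [hH, s, ρ, hv, hr.le, smul_smul, hr.ne']

/-- Any point of a connected open set can be moved to any other one by an isotopy supported in
this set. -/
theorem exists_isotopicToId_move {U : Set Plane} (hU : IsOpen U) (hc : IsPreconnected U)
    {a b : Plane} (ha : a ∈ U) (hb : b ∈ U) :
    ∃ φ : Plane ≃ₜ Plane, IsotopicToId φ ∧ (∀ x ∉ U, φ x = x) ∧ φ a = b := by
  let P : Plane → Plane → Prop := fun a b =>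
    ∃ φ : Plane ≃ₜ Plane, IsotopicToId φ ∧ (∀ x ∉ U, φ x = x) ∧ φ a = b
  refine hc.induction₂' P (fun x hx => ?_) ?_ ha hb
  · obtain ⟨ε, hε, hball⟩ := Metric.isOpen_iff.1 hU x hx
    refine mem_nhdsWithin_of_mem_nhds ?_
    filter_upwards [Metric.ball_mem_nhds x (half_pos hε)] with y hy
    have hxy : ∀ {z : Plane}, z ∉ U → z ∉ Metric.ball x (ε / 2) ∧ z ∉ Metric.ball y (ε / 2) := by
      intro z hz
      refine ⟨fun h => hz (hball (Metric.ball_subset_ball (by linarith) h)),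
        fun h => hz (hball ?_)⟩
      rw [Metric.mem_ball] at *
      linarith [dist_triangle z y x]
    obtain ⟨φ, h1, h2, h3⟩ := exists_isotopicToId_move_of_ball hy
    obtain ⟨ψ, h4, h5, h6⟩ := exists_isotopicToId_move_of_ball (Metric.mem_ball_comm.1 hy)
    exact ⟨⟨φ, h1, fun z hz => h2 z (hxy hz).1, h3⟩, ⟨ψ, h4, fun z hz => h5 z (hxy hz).2, h6⟩⟩
  · rintro x y z - - - ⟨φ, h1, h2, h3⟩ ⟨ψ, h4, h5, h6⟩
    refine ⟨φ.trans ψ, h1.trans h4, fun w hw => ?_, ?_⟩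
    · simp [h2 w hw, h5 w hw]
    · simp [h3, h6]

end Isotopies

section PeriodTwo

theorem exists_continuous_exp_eq {A : Type*} [TopologicalSpace A] [SimplyConnectedSpace A]
    [LocallyPathConnectedSpace A] {F : A → ℂ} (hF : Continuous F) (h0 : ∀ a, F a ≠ 0) :
    ∃ K : A → ℂ, Continuous K ∧ ∀ a, Complex.exp (K a) = F a := by
  obtain ⟨a₀⟩ : Nonempty A := inferInstance
  obtain ⟨K, ⟨-, hK⟩, -⟩ := Complex.isCoveringMapOn_exp.existsUnique_continuousMap_lifts
    (⟨F, hF⟩ : C(A, ℂ)) (a₀ := a₀) (e₀ := Complex.log (F a₀)) (Complex.exp_log (h0 a₀)) h0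
  exact ⟨K, K.continuous, fun a => congrFun hK a⟩

theorem eq_of_exp_eq_const {A : Type*} [TopologicalSpace A] [PreconnectedSpace A] {u : A → ℂ}
    (hu : Continuous u) {c : ℂ} (hc : ∀ a, Complex.exp (u a) = c) (a b : A) : u a = u b := by
  have := Complex.isCoveringMap_exp.eq_of_comp_eq hu (continuous_const (y := u b))
    (funext fun x => Subtype.ext ((hc x).trans (hc b).symm)) b rfl
  exact congrFun this a

theorem BrouwerHomeo.apply_apply_ne (h : BrouwerHomeo) (a : Plane) :
    h.toHomeomorph (h.toHomeomorph a) ≠ a := by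
  intro ha
  obtain ⟨f, ⟨H, hH, H0, H1⟩, hf⟩ := h
  simp only at ha
  let e : Plane → ℂ := Complex.equivRealProdCLM.symm
  have he : Continuous e := Complex.equivRealProdCLM.symm.continuous
  have hinj : Function.Injective e := Complex.equivRealProdCLM.symm.injective
  obtain ⟨K, hK, hKF⟩ := exists_continuous_exp_eq
    (F := fun p : ℝ × Plane => e (H p.1 (f p.2)) - e (H p.1 p.2))
    ((he.comp (hH.comp (continuous_fst.prodMk (f.continuous.comp continuous_snd)))).sub
      (he.comp hH))
    (fun p h0 => hf p.2 ((H p.1).injective (hinj (sub_eq_zero.1 h0))))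
  have h1 := eq_of_exp_eq_const (u := fun x => K (1, x) - K (0, f x)) (c := 1) (by fun_prop)
    (fun x => by
      rw [Complex.exp_sub, hKF, hKF]
      simp only [H0, H1, Homeomorph.refl_apply, id]
      exact div_self fun h0 => hf _ (hinj (sub_eq_zero.1 h0))) a (f a)
  have h2 := eq_of_exp_eq_const (u := fun t : ℝ => K (t, f a) - K (t, a)) (c := -1) (by fun_prop)
    (fun t => by
      rw [Complex.exp_sub, hKF, hKF]
      simp only [ha]
      rw [← neg_sub, neg_div, div_self]
      exact fun h0 => hf _ ((H t).injective (hinj (sub_eq_zero.1 h0)))) 0 1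
  simp only [ha] at h1 h2
  have h3 : K (0, f a) = K (0, a) := by linear_combination (h2 - h1) / 2
  have h4 := hKF (0, f a)
  rw [h3, hKF (0, a)] at h4
  simp only [ha, H0, Homeomorph.refl_apply, id] at h4
  exact hf a (hinj (by linear_combination h4 / 2))

end PeriodTwo

section FreeSets

namespace BrouwerHomeo

theorem isFree_iff {h : BrouwerHomeo} {E : Set Plane} :
    IsFree h E ↔ ∀ x ∈ E, h.toHomeomorph x ∉ E := by
  rw [IsFree, Set.disjoint_left, Set.forall_mem_image]

/-- Composing a Brouwer homeomorphism with an isotopy supported in a free set gives a Brouwer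
homeomorphism. -/
theorem exists_comp {h : BrouwerHomeo} {U : Set Plane} (hU : IsFree h U) {φ : Plane ≃ₜ Plane}
    (hφ : IsotopicToId φ) (hid : ∀ x ∉ U, φ x = x) :
    ∃ g : BrouwerHomeo, ∀ x, g.toHomeomorph x = φ (h.toHomeomorph x) := by
  refine ⟨⟨h.toHomeomorph.trans φ, h.orientationPreserving.trans hφ, fun x hx => ?_⟩,
    fun x => rfl⟩
  simp only [Homeomorph.trans_apply] at hx
  by_cases hx' : h.toHomeomorph x ∈ U
  · have : φ (h.toHomeomorph x) ∈ U := by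
      by_contra hn
      exact hn (by rwa [φ.injective (hid _ hn)])
    exact isFree_iff.1 hU x (hx ▸ this) hx'
  · exact h.fixedPointFree x (by rw [← hid _ hx', hx])

/-- A connected open free set does not meet its `n`-th iterate, provided that no Brouwer
homeomorphism has a point of period at most `n`. -/
theorem iterate_notMem_of_isFree {n : ℕ}
    (hper : ∀ m, 1 ≤ m → m ≤ n → ∀ (g : BrouwerHomeo) (x : Plane), g.toHomeomorph^[m] x ≠ x)
    {h : BrouwerHomeo} {U : Set Plane} (hUo : IsOpen U) (hUc : IsPreconnected U)
    (hU : IsFree h U) (hn : 1 ≤ n) {x : Plane} (hx : x ∈ U) : h.toHomeomorph^[n] x ∉ U := by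
  induction n using Nat.strong_induction_on generalizing x with
  | _ n ih =>
    intro hxn
    obtain ⟨φ, hφ, hid, hmove⟩ := exists_isotopicToId_move hUo hUc hxn hx
    obtain ⟨g, hg⟩ := exists_comp hU hφ hid
    have hiter : ∀ m < n, g.toHomeomorph^[m] x = h.toHomeomorph^[m] x := by
      intro m
      induction m with
      | zero => simp
      | succ k ihk =>
        intro hk
        rw [Function.iterate_succ_apply', ihk (by omega), hg,
          ← Function.iterate_succ_apply' h.toHomeomorph]
        exact hid _ (ih (k + 1) hk (fun m h1 h2 => hper m h1 (by omega)) (by omega) hx)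
    obtain ⟨k, rfl⟩ := Nat.exists_eq_add_of_le' hn
    refine hper (k + 1) hn le_rfl g x ?_
    rw [Function.iterate_succ_apply', hiter k (by omega), hg,
          ← Function.iterate_succ_apply' h.toHomeomorph, hmove]

/-- There is no periodic chain of two disjoint connected open free sets with return times `1`
and `n`, provided that no Brouwer homeomorphism has a point of period at most `n + 1`. -/
theorem iterate_notMem_of_isFree_of_disjoint {n : ℕ}
    (hper : ∀ m, 1 ≤ m → m ≤ n + 1 → ∀ (g : BrouwerHomeo) (x : Plane), g.toHomeomorph^[m] x ≠ x)
    {h : BrouwerHomeo} {U V : Set Plane} (hUo : IsOpen U) (hUc : IsPreconnected U)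
    (hU : IsFree h U) (hVo : IsOpen V) (hVc : IsPreconnected V) (hV : IsFree h V)
    (hUV : Disjoint U V) {z : Plane} (hz : z ∈ U) (hzV : h.toHomeomorph z ∈ V)
    {v : Plane} (hv : v ∈ V) : h.toHomeomorph^[n] v ∉ U := by
  induction n using Nat.strong_induction_on generalizing v with
  | _ n ih =>
    intro hvn
    obtain ⟨φ, hφ, hid, hmove⟩ := exists_isotopicToId_move hVo hVc hzV hv
    obtain ⟨g, hg⟩ := exists_comp hV hφ hid
    have hgU : IsFree g U := by
      refine isFree_iff.2 fun x hx hgx => ?_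
      rw [hg] at hgx
      by_cases hxV : h.toHomeomorph x ∈ V
      · refine Set.disjoint_left.1 hUV hgx ?_
        by_contra hn
        exact hn (by rwa [φ.injective (hid _ hn)])
      · rw [hid _ hxV] at hgx
        exact isFree_iff.1 hU x hx hgx
    have hnV : ∀ m, 1 ≤ m → m ≤ n → h.toHomeomorph^[m] v ∉ V := by
      intro m h1 h2 hmV
      refine ih (n - m) (by omega) (fun k h3 h4 => hper k h3 (by omega)) hmV ?_
      rwa [← Function.iterate_add_apply, Nat.sub_add_cancel h2]
    have hiter : ∀ m ≤ n, g.toHomeomorph^[m] v = h.toHomeomorph^[m] v := by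
      intro m
      induction m with
      | zero => simp
      | succ k ihk =>
        intro hk
        rw [Function.iterate_succ_apply', ihk (by omega), hg,
          ← Function.iterate_succ_apply' h.toHomeomorph]
        exact hid _ (hnV (k + 1) (by omega) hk)
    refine iterate_notMem_of_isFree hper hUo hUc hgU (by omega) hz ?_
    rwa [Function.iterate_succ_apply, hg, hmove, hiter n le_rfl]

end BrouwerHomeo

theorem IsPreconnected.thickening {E : Set Plane} (hE : IsPreconnected E) (δ : ℝ) :
    IsPreconnected (Metric.thickening δ E) := by
  rcases le_or_gt δ 0 with hδ | hδ
  · rw [Metric.thickening_of_nonpos hδ]; exact isPreconnected_empty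
  rcases E.eq_empty_or_nonempty with rfl | ⟨x₀, hx₀⟩
  · simpa using isPreconnected_empty
  refine isPreconnected_of_forall x₀ fun y hy => ?_
  obtain ⟨x, hx, hxy⟩ := Metric.mem_thickening_iff.1 hy
  refine ⟨E ∪ Metric.ball x δ, union_subset (Metric.self_subset_thickening hδ E)
    (Metric.ball_subset_thickening hx δ), Or.inl hx₀, Or.inr hxy, ?_⟩
  exact hE.union x hx (Metric.mem_ball_self hδ) (convex_ball x δ).isPreconnected

/-- A compact connected free set has arbitrarily small connected open free neighbourhoods. -/
theorem IsFree.exists_open_superset {h : BrouwerHomeo} {K O : Set Plane} (hK : IsFree h K)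
    (hKc : IsCompact K) (hKp : IsPreconnected K) (hO : IsOpen O) (hKO : K ⊆ O) :
    ∃ U, IsOpen U ∧ IsPreconnected U ∧ IsFree h U ∧ K ⊆ U ∧ U ⊆ O := by
  obtain ⟨O₁, O₂, h1, h2, h3, h4, h5⟩ :=
    SeparatedNhds.of_isCompact_isCompact (hKc.image h.toHomeomorph.continuous) hKc hK
  obtain ⟨δ, hδ, hsub⟩ := hKc.exists_thickening_subset_open
    (((h1.preimage h.toHomeomorph.continuous).inter h2).inter hO)
    (subset_inter (subset_inter (image_subset_iff.1 h3) h4) hKO)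
  refine ⟨Metric.thickening δ K, Metric.isOpen_thickening, hKp.thickening δ, ?_,
    Metric.self_subset_thickening hδ K, fun x hx => (hsub hx).2⟩
  exact BrouwerHomeo.isFree_iff.2 fun x hx hx' =>
    Set.disjoint_left.1 h5 (hsub hx).1.1 (hsub hx').1.2

end FreeSets

section Segments

theorem segment_diff_subset_ball {x y : Plane} {r : ℝ} (hr : 0 < r)
    (hy : y ∈ closure (Metric.ball x r)) : segment ℝ x y \ {y} ⊆ Metric.ball x r := by
  rintro p ⟨hp, hpy⟩
  rw [closure_ball x hr.ne', Metric.mem_closedBall, dist_eq_norm] at hy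
  obtain ⟨t, ⟨ht0, ht1⟩, rfl⟩ := (segment_eq_image' ℝ x y) ▸ hp
  have ht : t < 1 := lt_of_le_of_ne ht1 fun h1 => hpy (by simp [h1])
  rw [Metric.mem_ball, dist_eq_norm]
  simp only [add_sub_cancel_left, norm_smul, Real.norm_of_nonneg ht0]
  rcases ht0.eq_or_lt with rfl | ht0
  · simpa
  · nlinarith

theorem isCompact_segment (x y : Plane) : IsCompact (segment ℝ x y) := by
  rw [segment_eq_image']
  exact isCompact_Icc.image (by fun_prop)

theorem isPreconnected_segment (x y : Plane) : IsPreconnected (segment ℝ x y) :=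
  (convex_segment x y).isPreconnected

end Segments

namespace BrouwerHomeo

/-- Every point is the centre of a free ball whose boundary contains a point and its image. -/
theorem exists_critical_ball (h : BrouwerHomeo) (x : Plane) :
    ∃ r > 0, ∃ y, IsFree h (Metric.ball x r) ∧ y ∈ closure (Metric.ball x r) ∧
      h.toHomeomorph y ∈ closure (Metric.ball x r) := by
  obtain ⟨y, hy⟩ := Continuous.exists_forall_le
    (f := fun p : Plane => max (dist p x) (dist (h.toHomeomorph p) x))
    (by have := h.toHomeomorph.continuous; fun_prop)
    (tendsto_atTop_mono (fun p => le_max_left _ _) (tendsto_dist_right_cocompact_atTop x))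
  have hr : 0 < max (dist y x) (dist (h.toHomeomorph y) x) := by
    by_contra! hle
    have h1 : y = x := dist_le_zero.1 ((le_max_left _ _).trans hle)
    have h2 : h.toHomeomorph y = x := dist_le_zero.1 ((le_max_right _ _).trans hle)
    exact h.fixedPointFree y (h2.trans h1.symm)
  refine ⟨_, hr, y, isFree_iff.2 fun p hp hp' => ?_, ?_, ?_⟩
  · exact (hy p).not_gt (max_lt hp hp')
  · rw [closure_ball x hr.ne']
    exact le_max_left (dist y x) _
  · rw [closure_ball x hr.ne']
    exact le_max_right (dist y x) (dist (h.toHomeomorph y) x)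

/-- The induction step of Brouwer's theorem: a point of period at least three yields a point of
smaller period for another Brouwer homeomorphism. -/
theorem iterate_ne_of_three_le {n : ℕ} (hn : 3 ≤ n)
    (hper : ∀ m, 1 ≤ m → m < n → ∀ (g : BrouwerHomeo) (x : Plane), g.toHomeomorph^[m] x ≠ x)
    (h : BrouwerHomeo) (x : Plane) : h.toHomeomorph^[n] x ≠ x := by
  intro hx
  obtain ⟨r, hr, y, hB, hy, hw⟩ := h.exists_critical_ball x
  set f := h.toHomeomorph
  set B := Metric.ball x r
  have hfree := isFree_iff.1 hB
  have hxB : x ∈ B := Metric.mem_ball_self hr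
  have hBo : IsOpen B := Metric.isOpen_ball
  have hwB : f y ∉ B := by
    intro hyB
    obtain ⟨p, hp, hpB⟩ := mem_closure_iff.1 hy _ (hBo.preimage f.continuous) hyB
    exact hfree p hpB hp
  have hyfB : ∀ p ∈ B, f p ≠ y := by
    rintro p hp rfl
    obtain ⟨_, ⟨q, hq, rfl⟩, hqB⟩ := mem_closure_iff.1 hy _ (f.isOpenMap B hBo) ⟨p, hp, rfl⟩
    exact hfree q hq hqB
  have hByfree : IsFree h (insert y B) := by
    refine isFree_iff.2 ?_
    rintro p (rfl | hp) (hq | hq)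
    · exact h.fixedPointFree _ hq
    · exact hwB hq
    · exact hyfB p hp hq
    · exact hfree p hp hq
  have hxy : segment ℝ x y ⊆ insert y B := fun p hp => by
    by_cases hpy : p = y
    · exact Or.inl hpy
    · exact Or.inr (segment_diff_subset_ball hr hy ⟨hp, hpy⟩)
  have hmono : ∀ {E F : Set Plane}, E ⊆ F → IsFree h F → IsFree h E := fun hEF hF =>
    isFree_iff.2 fun p hp hp' => isFree_iff.1 hF p (hEF hp) (hEF hp')
  have hdisj : Disjoint ((fun p => f (f p)) '' segment ℝ x y) (segment ℝ x (f y)) := by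
    rw [Set.disjoint_left]
    rintro _ ⟨p, hp, rfl⟩ hq
    have hqB : f (f p) ∈ B := by
      refine segment_diff_subset_ball hr hw ⟨hq, fun he => ?_⟩
      have he' : f p = y := f.injective he
      rcases hxy hp with rfl | hpB
      · exact h.fixedPointFree _ he'
      · exact hyfB p hpB he'
    have hKsub : segment ℝ x y ∪ segment ℝ x (f (f p)) ⊆ insert y B :=
      union_subset hxy (((convex_ball x r).segment_subset hxB hqB).trans (subset_insert _ _))
    obtain ⟨U, hUo, hUc, hU, hKU, -⟩ := (hmono hKsub hByfree).exists_open_superset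
      ((isCompact_segment _ _).union (isCompact_segment _ _))
      ((isPreconnected_segment x y).union x (left_mem_segment ℝ _ _) (left_mem_segment ℝ _ _)
        (isPreconnected_segment _ _)) isOpen_univ (subset_univ _)
    exact iterate_notMem_of_isFree (n := 2) (fun m h1 h2 => hper m h1 (by omega)) hUo hUc hU
      (by norm_num) (hKU (Or.inl hp)) (hKU (Or.inr (right_mem_segment ℝ _ _)))
  have hffc : Continuous fun p => f (f p) := f.continuous.comp f.continuous
  have hLc := (isCompact_segment x y).image hffc
  obtain ⟨O₁, O₂, hO₁, hO₂, hLO, hSO, hOO⟩ :=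
    SeparatedNhds.of_isCompact_isCompact hLc (isCompact_segment x (f y)) hdisj
  have hLfree : IsFree h ((fun p => f (f p)) '' segment ℝ x y) := by
    refine isFree_iff.2 ?_
    rintro _ ⟨p, hp, rfl⟩ ⟨q, hq, hqp⟩
    have : q = f p := f.injective (f.injective hqp)
    exact isFree_iff.1 hByfree p (hxy hp) (this ▸ hxy hq)
  obtain ⟨V, hVo, hVc, hV, hLV, hVO⟩ := hLfree.exists_open_superset hLc
    ((isPreconnected_segment x y).image _ hffc.continuousOn) hO₁ hLO
  obtain ⟨z, hz, hzB, hzV⟩ : ∃ z ∈ segment ℝ x (f y), z ∈ B ∧ f z ∈ V := by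
    have hcont : Continuous fun t : ℝ => x + t • (f y - x) := by fun_prop
    have hnear : ∀ᶠ t in 𝓝[<] (1 : ℝ), f (x + t • (f y - x)) ∈ V := by
      refine ((f.continuous.comp hcont).tendsto 1).mono_left nhdsWithin_le_nhds |>.eventually
        (hVo.mem_nhds ?_)
      exact hLV ⟨y, right_mem_segment ℝ _ _, by simp⟩
    obtain ⟨t, htV, ht0, ht1⟩ := (hnear.and (Ioo_mem_nhdsLT zero_lt_one)).exists
    have hseg : x + t • (f y - x) ∈ segment ℝ x (f y) := by
      rw [segment_eq_image']
      exact ⟨t, ⟨ht0.le, ht1.le⟩, rfl⟩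
    refine ⟨_, hseg, segment_diff_subset_ball hr hw ⟨hseg, fun he => ?_⟩, htV⟩
    have h0 : (1 - t) • (f y - x) = 0 := by
      rw [sub_smul, one_smul, sub_eq_zero, sub_eq_iff_eq_add']
      exact he.symm
    rcases smul_eq_zero.1 h0 with h1 | h1
    · linarith
    · exact hwB (sub_eq_zero.1 h1 ▸ hxB)
  obtain ⟨U, hUo, hUc, hU, hzU, hUO⟩ :=
    (hmono ((convex_ball x r).segment_subset hxB hzB) hB).exists_open_superset
      (isCompact_segment x z) (isPreconnected_segment x z) hO₂
      (((convex_segment x (f y)).segment_subset (left_mem_segment ℝ _ _) hz).trans hSO)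
  refine iterate_notMem_of_isFree_of_disjoint (n := n - 2)
    (fun m h1 h2 => hper m h1 (by omega)) hUo hUc hU hVo hVc hV
    (hOO.symm.mono hUO hVO) (hzU (right_mem_segment ℝ _ _)) hzV
    (hLV ⟨x, left_mem_segment ℝ _ _, rfl⟩) ?_
  have hxn : f^[n - 2] (f (f x)) = x := by
    rw [← hx, ← Function.iterate_succ_apply, ← Function.iterate_succ_apply]
    congr 2
    · omega
  rw [hxn]
  exact hzU (left_mem_segment ℝ _ _)

/-- Brouwer's theorem: a Brouwer homeomorphism has no periodic point. -/
theorem iterate_ne {n : ℕ} (hn : 1 ≤ n) (h : BrouwerHomeo) (x : Plane) :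
    h.toHomeomorph^[n] x ≠ x := by
  induction n using Nat.strong_induction_on generalizing h x with
  | _ n ih =>
    rcases (by omega : n = 1 ∨ n = 2 ∨ 3 ≤ n) with rfl | rfl | h3
    · exact h.fixedPointFree x
    · exact h.apply_apply_ne x
    · exact iterate_ne_of_three_le h3 (fun m h1 h2 g y => ih m h2 h1 g y) h x

/-- A compact connected free set is disjoint from all its positive iterates. -/
theorem iterate_notMem_of_isCompact {h : BrouwerHomeo} {K : Set Plane} (hK : IsFree h K)
    (hKc : IsCompact K) (hKp : IsPreconnected K) {n : ℕ} (hn : 1 ≤ n) {x : Plane} (hx : x ∈ K) :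
    h.toHomeomorph^[n] x ∉ K := by
  obtain ⟨U, hUo, hUc, hU, hKU, -⟩ := hK.exists_open_superset hKc hKp isOpen_univ (subset_univ _)
  exact fun hxn => iterate_notMem_of_isFree (fun m h1 _ g y => iterate_ne h1 g y) hUo hUc hU hn
    (hKU hx) (hKU hxn)

theorem iter_natCast (h : BrouwerHomeo) (n : ℕ) : h.iter n = h.toHomeomorph^[n] := by
  rw [iter, zpow_natCast]
  exact Equiv.Perm.iterate_eq_pow _ _ |>.symm

theorem iter_neg_iter (h : BrouwerHomeo) (n : ℤ) (x : Plane) : h.iter (-n) (h.iter n x) = x := by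
  simp only [iter, zpow_neg]
  exact Equiv.symm_apply_apply _ _

end BrouwerHomeo

theorem IsClosedDisk.isCompact {D : Set Plane} (hD : IsClosedDisk D) : IsCompact D := by
  obtain ⟨e⟩ := hD
  have : CompactSpace (Metric.closedBall (0 : Plane) 1) :=
    isCompact_iff_compactSpace.1 (isCompact_closedBall _ _)
  exact isCompact_iff_compactSpace.2 e.symm.compactSpace

theorem IsClosedDisk.isPreconnected {D : Set Plane} (hD : IsClosedDisk D) : IsPreconnected D := by
  obtain ⟨e⟩ := hD
  have : PreconnectedSpace (Metric.closedBall (0 : Plane) 1) :=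
    isPreconnected_iff_preconnectedSpace.1 (convex_closedBall _ _).isPreconnected
  exact isPreconnected_iff_preconnectedSpace.2
    (e.symm.surjective.denseRange.preconnectedSpace e.symm.continuous)

/-- If `D` is a free closed topological disk for a Brouwer homeomorphism `h`,
then `D` is disjoint from the interior of `h^n(D)` for every nonzero integer `n`. -/
theorem free_disk_disjoint_interior_iterates (h : BrouwerHomeo) (D : Set Plane)
    (hD : IsClosedDisk D) (hfree : IsFree h D) :
    ∀ n : ℤ, n ≠ 0 → Disjoint D (interior (h.iter n '' D)) := by
  intro n hn
  refine Set.disjoint_left.2 fun x hx hxn => ?_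
  obtain ⟨y, hy, rfl⟩ := interior_subset hxn
  have key : ∀ {m : ℕ} {z : Plane}, 1 ≤ m → z ∈ D → h.iter m z ∉ D := fun hm hz => by
    rw [h.iter_natCast]
    exact BrouwerHomeo.iterate_notMem_of_isCompact hfree hD.isCompact hD.isPreconnected hm hz
  obtain ⟨m, rfl | rfl⟩ := n.eq_nat_or_neg
  · exact key (by omega) hy hx
  · refine key (m := m) (by omega) hx ?_
    have := h.iter_neg_iter (-m) y
    rw [neg_neg] at this
    rwa [this]
end

section
/- Let h be a Brouwer homeomorphism. Then every point of the plane is wandering: for every x ∈ ℝ² there exists a neighborhood V of x such that h^n(V) ∩ V = ∅ for all n ≠ 0. -/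
open Set Filter Topology

open scoped unitInterval

/-- `g` is joined to the identity by a continuous family of injective self-maps of `ℂ`. -/
def InjectivelyIsotopicToId (g : ℂ → ℂ) : Prop :=
  ∃ F : I × ℂ → ℂ, Continuous F ∧ (∀ t, Function.Injective fun p => F (t, p)) ∧
    (∀ p, F (0, p) = p) ∧ ∀ p, F (1, p) = g p

theorem exists_log_of_homotopy {A : Type*} [TopologicalSpace A] (F : I × A → ℂ)
    (hF : Continuous F) (hF0 : ∀ q, F q ≠ 0) (l : A → ℂ) (hl : Continuous l)
    (hl0 : ∀ a, F (0, a) = Complex.exp (l a)) :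
    ∃ L : I × A → ℂ, Continuous L ∧ ∀ q, Complex.exp (L q) = F q := by
  let H : C(I × A, {z : ℂ // z ≠ 0}) := ⟨fun q => ⟨F q, hF0 q⟩, by fun_prop⟩
  have h0 : ∀ a, H (0, a) = ⟨Complex.exp (l a), (l a).exp_ne_zero⟩ :=
    fun a => Subtype.ext (hl0 a)
  refine ⟨Complex.isCoveringMap_exp.liftHomotopy H ⟨l, hl⟩ h0, by fun_prop, fun q => ?_⟩
  exact congrArg Subtype.val (congrFun (Complex.isCoveringMap_exp.liftHomotopy_lifts H ⟨l, hl⟩ h0) q)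

theorem StarConvex.exists_log {E : Type*} [NormedAddCommGroup E] [NormedSpace ℝ E] {c : E}
    {S : Set E} (hS : StarConvex ℝ c S) (hc : c ∈ S) {f : E → ℂ} (hf : ContinuousOn f S)
    (hf0 : ∀ x ∈ S, f x ≠ 0) :
    ∃ l : E → ℂ, ContinuousOn l S ∧ ∀ x ∈ S, Complex.exp (l x) = f x := by
  classical
  have hmem : ∀ q : I × S, AffineMap.lineMap c (q.2 : E) (q.1 : ℝ) ∈ S := fun q =>
    hS.segment_subset q.2.2 (segment_eq_image_lineMap ℝ c q.2.1 ▸ mem_image_of_mem _ q.1.2)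
  obtain ⟨L, hL, hexp⟩ := exists_log_of_homotopy
    (fun q : I × S => f (AffineMap.lineMap c (q.2 : E) (q.1 : ℝ)))
    (hf.comp_continuous (by simp only [AffineMap.lineMap_apply_module]; fun_prop) hmem)
    (fun q => hf0 _ (hmem q)) (fun _ => Complex.log (f c)) continuous_const
    (fun a => by simp [Complex.exp_log (hf0 c hc)])
  refine ⟨fun x => if hx : x ∈ S then L (1, ⟨x, hx⟩) else 0, ?_, fun x hx => ?_⟩
  · rw [continuousOn_iff_continuous_domRestrict]
    have : S.domRestrict (fun x => if hx : x ∈ S then L (1, ⟨x, hx⟩) else 0)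
        = fun x : S => L (1, x) := by
      ext x; simp
    rw [this]; fun_prop
  · simp [hx, hexp]

theorem IsPreconnected.eq_of_exp_eq {X : Type*} [TopologicalSpace X] {S : Set X}
    (hS : IsPreconnected S) {f : X → ℂ} (hf : ContinuousOn f S) {w : ℂ}
    (hexp : ∀ x ∈ S, Complex.exp (f x) = w) {x y : X} (hx : x ∈ S) (hy : y ∈ S) : f x = f y :=
  Complex.isCoveringMap_exp.constOn_of_comp hS hf
    (fun a ha b hb => Subtype.ext ((hexp a ha).trans (hexp b hb).symm)) hx hy

theorem InjectivelyIsotopicToId.exists_log {g : ℂ → ℂ} (hg : InjectivelyIsotopicToId g) :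
    ∃ A : ℂ → ℂ → ℂ, ContinuousOn (fun q : ℂ × ℂ => A q.1 q.2) {q | q.1 ≠ q.2} ∧
      (∀ p q, A p q = A q p) ∧ ∀ p q, p ≠ q → g q - g p = (q - p) * Complex.exp (A p q) := by
  classical
  obtain ⟨F, hF, hinj, h0, h1⟩ := hg
  let C : Set (ℂ × ℂ) := {q | q.1 ≠ q.2}
  have hne : ∀ q : C, (q.1.2 - q.1.1 : ℂ) ≠ 0 := fun q => sub_ne_zero.2 (Ne.symm q.2)
  let K : I × C → ℂ := fun q => (F (q.1, q.2.1.2) - F (q.1, q.2.1.1)) / (q.2.1.2 - q.2.1.1)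
  have hK : Continuous K := by
    refine Continuous.div (by fun_prop) (by fun_prop) fun q => hne q.2
  obtain ⟨L, hL, hexp⟩ := exists_log_of_homotopy K hK
    (fun q => div_ne_zero (sub_ne_zero.2 fun h => hne q.2 (sub_eq_zero.2 (hinj q.1 h))) (hne q.2))
    (fun _ => 0) continuous_const (fun a => by simp [K, h0, hne a])
  let A : ℂ → ℂ → ℂ := fun p q => if h : p ≠ q then L (1, ⟨(p, q), h⟩) - L (0, ⟨(p, q), h⟩) else 0
  refine ⟨A, ?_, fun p q => ?_, fun p q hpq => ?_⟩
  · rw [continuousOn_iff_continuous_domRestrict]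
    have : C.domRestrict (fun q : ℂ × ℂ => A q.1 q.2) = fun x : C => L (1, x) - L (0, x) := by
      ext x
      have hx : x.1.1 ≠ x.1.2 := x.2
      simp [A, hx]
    exact this ▸ (by fun_prop : Continuous fun x : C => L (1, x) - L (0, x))
  · by_cases hpq : p = q
    · rw [hpq]
    · have hqp : q ≠ p := Ne.symm hpq
      let D : I → ℂ := fun t => L (t, ⟨(p, q), hpq⟩) - L (t, ⟨(q, p), hqp⟩)
      have hD : D 0 = D 1 := by
        refine isPreconnected_univ.eq_of_exp_eq (f := D) (w := 1) (by fun_prop) (fun t _ => ?_)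
          (mem_univ _) (mem_univ _)
        have hKK : K (t, ⟨(p, q), hpq⟩) = K (t, ⟨(q, p), hqp⟩) := by
          simp only [K]
          rw [← neg_sub (F (t, p)), ← neg_sub p q, neg_div_neg_eq]
        rw [Complex.exp_sub, hexp, hexp, hKK, div_self]
        rw [← hexp]; exact Complex.exp_ne_zero _
      simp only [A, dif_pos hqp, dif_pos (show p ≠ q from hpq)]
      simp only [D] at hD
      linear_combination -hD
  · have := sub_ne_zero.2 hpq.symm
    simp only [A, dif_pos hpq, Complex.exp_sub, hexp, K, h0, h1]
    field_simp

theorem starConvex_triangle_diff_singleton {s T : ℝ} (hT : 0 < T) :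
    StarConvex ℝ ((T / 3, 2 * T / 3) : ℝ × ℝ)
      ({q : ℝ × ℝ | 0 ≤ q.1 ∧ q.1 < q.2 ∧ q.2 ≤ T} \ {(s, T)}) := by
  rintro ⟨a, b⟩ ⟨⟨ha, hab, hb⟩, hne⟩ u v hu hv huv
  simp only at ha hab hb
  rcases hu.eq_or_lt with rfl | hu
  · obtain rfl : v = 1 := by linarith
    simpa using ⟨⟨ha, hab, hb⟩, by simpa using hne⟩
  · obtain rfl : v = 1 - u := by linarith
    have h2 : u * (2 * T / 3) + (1 - u) * b < T := by nlinarith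
    refine ⟨⟨?_, ?_, ?_⟩, fun h => ?_⟩
    · simp only [Prod.smul_mk, Prod.mk_add_mk, smul_eq_mul]
      positivity
    · simp only [Prod.smul_mk, Prod.mk_add_mk, smul_eq_mul]
      nlinarith
    · simpa using h2.le
    · simp only [Prod.smul_mk, Prod.mk_add_mk, smul_eq_mul, mem_singleton_iff,
        Prod.mk.injEq] at h
      linarith [h.2]

/-- A fixed point free map isotopic to the identity through injective maps admits no trajectory
`Γ (t + 1) = g (Γ t)` that is injective up to a time `T ≥ 2` at which it closes up, the
resulting loop having duration more than `1`. -/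
theorem InjectivelyIsotopicToId.false_of_simple_closed_trajectory {g : ℂ → ℂ}
    (hg : InjectivelyIsotopicToId g) (hcont : Continuous g) (hfix : ∀ p, g p ≠ p)
    {Γ : ℝ → ℂ} {s T : ℝ} (hs : 0 ≤ s) (hsT : s + 1 < T) (hT : 2 ≤ T)
    (hΓ : ContinuousOn Γ (Icc 0 T)) (hstep : ∀ t, 0 ≤ t → t + 1 ≤ T → Γ (t + 1) = g (Γ t))
    (hclose : Γ s = Γ T)
    (hinj : ∀ a b, 0 ≤ a → a < b → b ≤ T → Γ a = Γ b → a = s ∧ b = T) : False := by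
  obtain ⟨A, hA, hsymm, hAexp⟩ := hg.exists_log
  obtain ⟨θ, hθ, hθexp⟩ := (convex_univ.starConvex (mem_univ (0 : ℂ))).exists_log (mem_univ _)
    (f := fun x => g x - x) (by fun_prop) (fun x _ => sub_ne_zero.2 (hfix x))
  rw [continuousOn_univ] at hθ
  replace hθexp : ∀ x, Complex.exp (θ x) = g x - x := fun x => hθexp x (mem_univ x)
  set E : Set (ℝ × ℝ) := {q | 0 ≤ q.1 ∧ q.1 < q.2 ∧ q.2 ≤ T} \ {(s, T)}
  have hEne : ∀ q ∈ E, Γ q.1 ≠ Γ q.2 := fun q hq h => by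
    obtain ⟨h1, h2⟩ := hinj q.1 q.2 hq.1.1 hq.1.2.1 hq.1.2.2 h
    exact hq.2 (Prod.ext h1 h2)
  have hΓ1 : ContinuousOn (fun q : ℝ × ℝ => Γ q.1) E :=
    hΓ.comp continuousOn_fst fun q hq => ⟨hq.1.1, hq.1.2.1.le.trans hq.1.2.2⟩
  have hΓ2 : ContinuousOn (fun q : ℝ × ℝ => Γ q.2) E :=
    hΓ.comp continuousOn_snd fun q hq => ⟨hq.1.1.trans hq.1.2.1.le, hq.1.2.2⟩
  obtain ⟨Θ, hΘ, hΘexp⟩ := (starConvex_triangle_diff_singleton (s := s)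
    (by linarith : 0 < T)).exists_log (f := fun q => Γ q.2 - Γ q.1)
    ⟨⟨by simp only; linarith, by simp only; linarith, by simp only; linarith⟩, fun h => by
      simp only [mem_singleton_iff, Prod.mk.injEq] at h; linarith [h.2]⟩
    (hΓ2.sub hΓ1) (fun q hq => sub_ne_zero.2 (hEne q hq).symm)
  have mem : ∀ {a b : ℝ}, 0 ≤ a → a < b → b ≤ T → (b = T → a ≠ s) → (a, b) ∈ E :=
    fun h1 h2 h3 h4 => ⟨⟨h1, h2, h3⟩, fun h => by
      simp only [mem_singleton_iff, Prod.mk.injEq] at h; exact h4 h.2 h.1⟩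
  have hs1 : s < 1 := by
    by_contra! h
    have h1 := hstep (s - 1) (by linarith) (by linarith)
    have h2 := hstep (T - 1) (by linarith) (by linarith)
    simp only [sub_add_cancel] at h1 h2
    by_cases h3 : Γ (s - 1) = Γ (T - 1)
    · linarith [(hinj _ _ (by linarith) (by linarith) (by linarith) h3).2]
    · have := hAexp _ _ h3
      rw [← h1, ← h2, hclose, sub_self, eq_comm, mul_eq_zero, sub_eq_zero] at this
      exact this.elim (fun h => h3 h.symm) (Complex.exp_ne_zero _)
  -- the four cocycle relations
  have rel1 : ∀ x y, θ (g x) - θ x - A x (g x) = θ (g y) - θ y - A y (g y) := fun x y => by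
    refine isPreconnected_univ.eq_of_exp_eq (f := fun x => θ (g x) - θ x - A x (g x)) (w := 1)
      ?_ (fun x _ => ?_) (mem_univ x) (mem_univ y)
    · have : ContinuousOn (fun x => A x (g x)) univ :=
        hA.comp (f := fun x => (x, g x)) (by fun_prop) fun x _ => (hfix x).symm
      exact ((hθ.comp hcont).sub hθ).continuousOn.sub this
    · have := hAexp x (g x) (hfix x).symm
      have h0 := sub_ne_zero.2 (hfix x)
      rw [Complex.exp_sub, Complex.exp_sub, hθexp, hθexp, this]
      field_simp
  have rel2 : ∀ a b a' b', 0 ≤ a → a < b → b ≤ T - 1 → 0 ≤ a' → a' < b' → b' ≤ T - 1 →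
      Θ (a + 1, b + 1) - Θ (a, b) - A (Γ a) (Γ b)
        = Θ (a' + 1, b' + 1) - Θ (a', b') - A (Γ a') (Γ b') := by
    intro a b a' b' h1 h2 h3 h1' h2' h3'
    let S : Set (ℝ × ℝ) := {q | 0 ≤ q.1 ∧ q.1 < q.2 ∧ q.2 ≤ T - 1}
    have hS : Convex ℝ S := by
      rintro ⟨a, b⟩ ⟨ha, hab, hb⟩ ⟨a', b'⟩ ⟨ha', hab', hb'⟩ u v hu hv huv
      obtain rfl : v = 1 - u := by linarith
      simp only at ha hab hb ha' hab' hb'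
      refine ⟨?_, ?_, ?_⟩ <;> simp only [Prod.smul_mk, Prod.mk_add_mk, smul_eq_mul]
      · positivity
      · rcases hu.eq_or_lt with rfl | hu
        · linarith
        · nlinarith
      · nlinarith
    have hSE : ∀ q ∈ S, q ∈ E := fun q hq => mem hq.1 hq.2.1 (by linarith [hq.2.2])
      fun h => by linarith [hq.2.2]
    have hSE' : ∀ q ∈ S, (q.1 + 1, q.2 + 1) ∈ E := fun q hq => mem (by linarith [hq.1])
      (by linarith [hq.2.1]) (by linarith [hq.2.2]) fun _ h => by linarith [hq.1]
    refine hS.isPreconnected.eq_of_exp_eq (w := 1)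
      (f := fun q => Θ (q.1 + 1, q.2 + 1) - Θ (q.1, q.2) - A (Γ q.1) (Γ q.2))
      ?_ (fun q hq => ?_) (show (a, b) ∈ S from ⟨h1, h2, h3⟩)
      (show (a', b') ∈ S from ⟨h1', h2', h3'⟩)
    · refine ((hΘ.comp (by fun_prop) hSE').sub (hΘ.mono hSE)).sub ?_
      exact hA.comp (f := fun q : ℝ × ℝ => (Γ q.1, Γ q.2))
        ((hΓ1.mono hSE).prodMk (hΓ2.mono hSE)) fun q hq => hEne q (hSE q hq)
    · have hne := hEne q (hSE q hq)
      have := hAexp _ _ hne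
      have h0 := sub_ne_zero.2 hne.symm
      rw [Complex.exp_sub, Complex.exp_sub, hΘexp _ (hSE' q hq), hΘexp _ (hSE q hq)]
      simp only
      rw [hstep q.1 hq.1 (by linarith [hq.2.1, hq.2.2]),
        hstep q.2 (by linarith [hq.1, hq.2.1]) (by linarith [hq.2.2]), this]
      field_simp
  have rel3 : ∀ t t', 0 ≤ t → t + 1 ≤ T → 0 ≤ t' → t' + 1 ≤ T →
      θ (Γ t) - Θ (t, t + 1) = θ (Γ t') - Θ (t', t' + 1) := by
    intro t t' h1 h2 h1' h2'
    have hmem : ∀ t ∈ Icc 0 (T - 1), (t, t + 1) ∈ E := fun t ht =>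
      mem ht.1 (by linarith) (by linarith [ht.2]) fun _ h => by linarith
    refine isPreconnected_Icc.eq_of_exp_eq (w := 1) (f := fun t => θ (Γ t) - Θ (t, t + 1))
      ?_ (fun t ht => ?_) (show t ∈ Icc 0 (T - 1) from ⟨h1, by linarith⟩)
      (show t' ∈ Icc 0 (T - 1) from ⟨h1', by linarith⟩)
    · refine (hθ.comp_continuousOn (hΓ.mono (Icc_subset_Icc_right (by linarith)))).sub ?_
      exact hΘ.comp (by fun_prop) hmem
    · rw [Complex.exp_sub, hθexp, hΘexp _ (hmem t ht)]
      simp only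
      rw [hstep t ht.1 (by linarith [ht.2]), div_self (sub_ne_zero.2 (hfix _))]
  have hmem4 : ∀ b ∈ Ioo s T, (b, T) ∈ E ∧ (s, b) ∈ E := fun b hb =>
    ⟨mem (hs.trans hb.1.le) hb.2 le_rfl fun _ h => hb.1.ne' h,
      mem hs hb.1 hb.2.le fun h => absurd h hb.2.ne⟩
  have exp4 : ∀ b ∈ Ioo s T, Complex.exp (Θ (b, T) - Θ (s, b)) = -1 := fun b hb => by
    have h0 := sub_ne_zero.2 (hEne _ (hmem4 b hb).2).symm
    rw [Complex.exp_sub, hΘexp _ (hmem4 b hb).1, hΘexp _ (hmem4 b hb).2]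
    simp only at h0 ⊢
    rw [← hclose, ← neg_sub (Γ b), neg_div, div_self h0]
  have rel4 : ∀ b ∈ Ioo s T, ∀ b' ∈ Ioo s T, Θ (b, T) - Θ (s, b) = Θ (b', T) - Θ (s, b') := by
    intro b hb b' hb'
    refine isPreconnected_Ioo.eq_of_exp_eq (w := -1) (f := fun b => Θ (b, T) - Θ (s, b))
      ?_ exp4 hb hb'
    exact (hΘ.comp (by fun_prop) fun b hb => (hmem4 b hb).1).sub
      (hΘ.comp (by fun_prop) fun b hb => (hmem4 b hb).2)
  have hm1 : T - 1 ∈ Ioo s T := ⟨by linarith, by linarith⟩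
  have e1 := rel1 (Γ 0) (Γ (T - 1))
  have e2 := rel2 0 1 s (T - 1) le_rfl one_pos (by linarith) hs (by linarith) le_rfl
  have e3 := rel3 0 1 le_rfl (by linarith) zero_le_one (by linarith)
  have e3' := rel3 0 s le_rfl (by linarith) hs (by linarith)
  have e3'' := rel3 0 (T - 1) le_rfl (by linarith) (by linarith) (by linarith)
  have e4 := rel4 (T - 1) hm1 (s + 1) ⟨by linarith, hsT⟩
  have g0 := hstep 0 le_rfl (by linarith)
  have gT := hstep (T - 1) (by linarith) (by linarith)
  have hε := exp4 _ hm1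
  simp only [zero_add, sub_add_cancel] at e1 e2 e3 e3' e3'' g0 gT
  rw [← g0, ← gT, ← hclose, hsymm (Γ (T - 1))] at e1
  have hz : Θ (T - 1, T) - Θ (s, T - 1) = 0 := by
    linear_combination (1 / 2) * (e1 - e2 + e3 + e4 - e3' + e3'')
  rw [hz, Complex.exp_zero] at hε
  norm_num at hε

/-- The trajectory obtained by concatenating the arcs `α`, `g ∘ α`, `g ∘ g ∘ α`, … -/
noncomputable def concatIterates (g : ℂ → ℂ) (α : ℝ → ℂ) (t : ℝ) : ℂ :=
  g^[⌊t⌋₊] (α (t - ⌊t⌋₊))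

section concatIterates

variable {g : ℂ → ℂ} {α : ℝ → ℂ}

theorem concatIterates_add_one {t : ℝ} (ht : 0 ≤ t) :
    concatIterates g α (t + 1) = g (concatIterates g α t) := by
  simp only [concatIterates, Nat.floor_add_one ht, Function.iterate_succ_apply']
  push_cast
  ring_nf

theorem concatIterates_add_natCast {t : ℝ} (ht : 0 ≤ t) (n : ℕ) :
    concatIterates g α (t + n) = g^[n] (concatIterates g α t) := by
  induction n with
  | zero => simp
  | succ n ih =>
    rw [Function.iterate_succ_apply', ← ih, ← concatIterates_add_one (g := g) (α := α) (t := t + n) (by positivity)]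
    push_cast
    ring_nf

theorem concatIterates_of_mem_Icc (h1 : α 1 = g (α 0)) {t : ℝ} (ht : t ∈ Icc (0 : ℝ) 1) :
    concatIterates g α t = α t := by
  rcases ht.2.eq_or_lt with rfl | h
  · simp [concatIterates, h1]
  · simp [concatIterates, Nat.floor_eq_zero.2 h]

theorem continuousOn_concatIterates (hg : Continuous g) (hα : Continuous α)
    (h1 : α 1 = g (α 0)) (n : ℕ) : ContinuousOn (concatIterates g α) (Icc 0 (n + 1)) := by
  have h01 : ContinuousOn (concatIterates g α) (Icc 0 1) :=
    hα.continuousOn.congr fun t ht => concatIterates_of_mem_Icc h1 ht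
  induction n with
  | zero => simpa using h01
  | succ n ih =>
    have h2 : ContinuousOn (concatIterates g α) (Icc 1 (n + 1 + 1)) := by
      refine (hg.comp_continuousOn (ih.comp (f := fun t : ℝ => t - 1) (s := Icc 1 (n + 1 + 1))
        (by fun_prop) fun t ht => ⟨by linarith [ht.1], by linarith [ht.2]⟩)).congr fun t ht => ?_
      have := concatIterates_add_one (g := g) (α := α) (t := t - 1) (by linarith [ht.1])
      simpa using this
    have := h01.union_of_isClosed h2 isClosed_Icc isClosed_Icc
    rw [Icc_union_Icc_eq_Icc zero_le_one (by linarith [n.cast_nonneg (α := ℝ)])] at this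
    exact_mod_cast this

end concatIterates

/-- A fixed point free map isotopic to the identity through injective maps has no periodic point
on a translation arc. -/
theorem InjectivelyIsotopicToId.false_of_periodic_mem_translation_arc {g : ℂ → ℂ}
    (hg : InjectivelyIsotopicToId g) (hcont : Continuous g) (hginj : Function.Injective g)
    (hfix : ∀ p, g p ≠ p) {α : ℝ → ℂ} (hα : Continuous α) (h1 : α 1 = g (α 0))
    (hαinj : InjOn α (Icc 0 1)) (hαg : ∀ t ∈ Ioo (0 : ℝ) 1, g (α t) ∉ α '' Icc 0 1)
    {c : ℝ} (hc : c ∈ Icc (0 : ℝ) 1) {N : ℕ} (hN : 0 < N) (hper : g^[N] (α c) = α c) :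
    False := by
  set Γ := concatIterates g α with hΓdef
  have hΓα : ∀ t ∈ Icc (0 : ℝ) 1, Γ t = α t := fun t => concatIterates_of_mem_Icc h1
  have hstep : ∀ t, 0 ≤ t → Γ (t + 1) = g (Γ t) := fun t => concatIterates_add_one
  have inj_two : ∀ a b, 0 ≤ a → a < b → b < 2 → Γ a ≠ Γ b := by
    intro a b ha hab hb h
    rcases le_or_gt b 1 with hb1 | hb1
    · have ha' : a ∈ Icc (0 : ℝ) 1 := ⟨ha, by linarith⟩
      have hb' : b ∈ Icc (0 : ℝ) 1 := ⟨by linarith, hb1⟩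
      rw [hΓα a ha', hΓα b hb'] at h
      exact hab.ne (hαinj ha' hb' h)
    · have hb' : b - 1 ∈ Icc (0 : ℝ) 1 := ⟨by linarith, by linarith⟩
      have hbg : Γ b = g (α (b - 1)) := by
        rw [← hΓα _ hb', ← hstep _ hb'.1, sub_add_cancel]
      rcases le_or_gt a 1 with ha1 | ha1
      · refine hαg (b - 1) ⟨by linarith, by linarith⟩ ⟨a, ⟨ha, ha1⟩, ?_⟩
        rw [← hbg, ← h, hΓα a ⟨ha, ha1⟩]
      · have ha' : a - 1 ∈ Icc (0 : ℝ) 1 := ⟨by linarith, by linarith⟩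
        have hag : Γ a = g (α (a - 1)) := by
          rw [← hΓα _ ha', ← hstep _ ha'.1, sub_add_cancel]
        have := hαinj ha' hb' (hginj (hag ▸ hbg ▸ h))
        linarith
  have inj_close : ∀ a b, 0 ≤ a → a < b → Γ a = Γ b → a + 1 ≤ b := by
    intro a b ha hab h
    by_contra! hlt
    have hf := Nat.floor_le ha
    have hf' := Nat.lt_floor_add_one a
    have e : ∀ t, (⌊a⌋₊ : ℝ) ≤ t → Γ t = g^[⌊a⌋₊] (Γ (t - ⌊a⌋₊)) := fun t ht => by
      rw [hΓdef, ← concatIterates_add_natCast (by linarith), sub_add_cancel]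
    rw [e a hf, e b (by linarith)] at h
    exact inj_two _ _ (by linarith) (by linarith) (by linarith) (hginj.iterate _ h)
  have hΓc : ContinuousOn Γ (Icc 0 (N + 1)) := continuousOn_concatIterates hcont hα h1 N
  set K : Set (ℝ × ℝ) :=
    (Icc 0 ((N : ℝ) + 1) ×ˢ Icc 0 ((N : ℝ) + 1)) ∩
      {q | q.1 + 1 ≤ q.2 ∧ Γ q.1 = Γ q.2} with hK
  have hKc : IsCompact K := by
    refine (isCompact_Icc.prod isCompact_Icc).of_isClosed_subset ?_ inter_subset_left
    have hcl : IsClosed (Icc 0 ((N : ℝ) + 1) ×ˢ Icc 0 ((N : ℝ) + 1)) :=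
      isClosed_Icc.prod isClosed_Icc
    have hd : ContinuousOn (fun q : ℝ × ℝ => Γ q.1 - Γ q.2)
        (Icc 0 ((N : ℝ) + 1) ×ˢ Icc 0 ((N : ℝ) + 1)) :=
      (hΓc.comp continuousOn_fst fun q hq => hq.1).sub
        (hΓc.comp continuousOn_snd fun q hq => hq.2)
    have h2 := hd.preimage_isClosed_of_isClosed hcl (isClosed_singleton (x := (0 : ℂ)))
    have h3 : IsClosed {q : ℝ × ℝ | q.1 + 1 ≤ q.2} :=
      isClosed_le (by fun_prop) (by fun_prop)
    convert! h2.inter h3 using 1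
    ext q
    simp only [hK, mem_inter_iff, mem_preimage, mem_singleton_iff, sub_eq_zero, mem_ofPred_eq]
    tauto
  have hN1 : (1 : ℝ) ≤ N := by exact_mod_cast hN
  have hKne : K.Nonempty := by
    refine ⟨(c, c + N), ⟨⟨hc.1, by linarith [hc.2]⟩, by linarith [hc.1], by linarith [hc.2]⟩,
      by simpa using hN1, ?_⟩
    simp only [hΓdef]
    rw [concatIterates_add_natCast hc.1, concatIterates_of_mem_Icc h1 hc, hper]
  obtain ⟨⟨s, T⟩, ⟨⟨hs, hT⟩, hsT, hclose⟩, hmin⟩ := hKc.exists_isMinOn hKne continuousOn_snd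
  simp only at hs hT hsT hclose
  have hmin' : ∀ a b, 0 ≤ a → a < b → Γ a = Γ b → T ≤ b := by
    intro a b ha hab h
    by_contra! hb
    have := hmin (show (a, b) ∈ K from ⟨⟨⟨ha, by linarith [hT.2]⟩, by linarith,
      by linarith [hT.2]⟩, inj_close a b ha hab h, h⟩)
    simp only [mem_ofPred_eq] at this
    linarith
  refine hg.false_of_simple_closed_trajectory hcont hfix hs.1 (T := T) ?_ ?_
    (hΓc.mono (Icc_subset_Icc_right hT.2)) (fun t ht _ => hstep t ht) hclose ?_
  · refine lt_of_le_of_ne hsT fun h => hfix (Γ s) ?_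
    rw [← hstep s hs.1, h, hclose]
  · by_contra! h
    exact inj_two s T hs.1 (by linarith) h hclose
  · intro a b ha hab hb h
    obtain rfl : b = T := le_antisymm hb (hmin' a b ha hab h)
    refine ⟨?_, rfl⟩
    rcases lt_trichotomy a s with has | has | has
    · linarith [hmin' a s ha has (h.trans hclose.symm)]
    · exact has
    · linarith [hmin' s a hs.1 has (hclose.trans h.symm)]

theorem preimage_add_left_mem_nhds_zero {E : Type*} [NormedAddCommGroup E] {U : Set E}
    {y : E} (hU : IsOpen U) (hy : y ∈ U) :
    (y + ·) ⁻¹' U ∈ 𝓝 (0 : E) :=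
  (hU.preimage (continuous_const_add y)).mem_nhds (by simpa using hy)

section gauge

variable {E : Type*} [NormedAddCommGroup E] [NormedSpace ℝ E] {U : Set E} {y : E}

theorem gauge_sub_lt_one_iff (hUc : Convex ℝ U) (hU : IsOpen U) (hy : y ∈ U) {p : E} :
    gauge ((y + ·) ⁻¹' U) (p - y) < 1 ↔ p ∈ U := by
  rw [gauge_lt_one_iff_mem_interior (hUc.translate_preimage_right _)
    (preimage_add_left_mem_nhds_zero hU hy), (hU.preimage (continuous_const_add y)).interior_eq]
  simp

theorem gauge_sub_eq_one (hUc : Convex ℝ U) (hU : IsOpen U) (hy : y ∈ U) {p : E}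
    (hp : p ∈ closure U) (hpU : p ∉ U) : gauge ((y + ·) ⁻¹' U) (p - y) = 1 := by
  refine le_antisymm ?_ (not_lt.1 fun h => hpU ((gauge_sub_lt_one_iff hUc hU hy).1 h))
  rw [gauge_le_one_iff_mem_closure (hUc.translate_preimage_right _)
    (preimage_add_left_mem_nhds_zero hU hy)]
  have := (Homeomorph.addLeft y).preimage_closure U
  simp only [Homeomorph.coe_addLeft] at this
  rw [← this]
  simpa using hp

/-- A point of a convex open set can be pushed to any other one by an isotopy supported in it. -/
theorem exists_isotopy_push (hUc : Convex ℝ U) (hU : IsOpen U) {w : E} (hw : w ∈ U)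
    (hy : y ∈ U) :
    ∃ Φ : I × E → E, Continuous Φ ∧ (∀ t, Function.Injective fun p => Φ (t, p)) ∧
      (∀ p, Φ (0, p) = p) ∧ (∀ t, ∀ p ∉ U, Φ (t, p) = p) ∧ (∀ t, ∀ p ∈ U, Φ (t, p) ∈ U) ∧
      Φ (1, w) = y := by
  set S := (w + ·) ⁻¹' U
  have hS : Convex ℝ S := hUc.translate_preimage_right _
  have hS0 : S ∈ 𝓝 (0 : E) := preimage_add_left_mem_nhds_zero hU hw
  have habs : Absorbent ℝ S := absorbent_nhds_zero hS0
  have hmem : ∀ p, gauge S (p - w) < 1 ↔ p ∈ U := fun p => gauge_sub_lt_one_iff hUc hU hw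
  have hγ : gauge S (y - w) < 1 := (hmem y).2 hy
  have hγ0 : 0 ≤ gauge S (y - w) := gauge_nonneg _
  have hgc : Continuous (gauge S) := continuous_gauge hS hS0
  set f : E → ℝ := fun p => max 0 (1 - gauge S (p - w)) with hf
  have hfc : Continuous f := by fun_prop
  have hfU : ∀ p ∈ U, f p = 1 - gauge S (p - w) := fun p hp =>
    max_eq_right (by linarith [(hmem p).2 hp])
  have hadd : ∀ p r, 0 ≤ r →
      gauge S (p + r • (y - w) - w) ≤ gauge S (p - w) + r * gauge S (y - w) := fun p r hr => by
    have := gauge_add_le hS habs (p - w) (r • (y - w))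
    rwa [gauge_smul_of_nonneg hr, smul_eq_mul, sub_add_eq_add_sub] at this
  refine ⟨fun q => q.2 + ((q.1 : ℝ) * f q.2) • (y - w), by fun_prop, fun t => ?_, by simp,
    fun t p hp => ?_, fun t p hp => ?_, ?_⟩
  · have key : ∀ p r, 0 ≤ r → r = t * (f p - f (p + r • (y - w))) → r = 0 := by
      intro p r hr h
      have h1 : f p - r * gauge S (y - w) ≤ f (p + r • (y - w)) := by
        simp only [hf]
        have := hadd p r hr
        have := mul_nonneg hr hγ0
        rw [sub_le_iff_le_add, max_le_iff]
        constructor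
        · linarith [le_max_left 0 (1 - gauge S (p + r • (y - w) - w))]
        · linarith [le_max_right 0 (1 - gauge S (p + r • (y - w) - w))]
      have h2 : r ≤ t * (r * gauge S (y - w)) :=
        h.le.trans (mul_le_mul_of_nonneg_left (by linarith) t.2.1)
      have h3 : (t : ℝ) * (r * gauge S (y - w)) ≤ r * gauge S (y - w) :=
        mul_le_of_le_one_left (mul_nonneg hr hγ0) t.2.2
      nlinarith
    have key' : ∀ p p', p + ((t : ℝ) * f p) • (y - w) = p' + ((t : ℝ) * f p') • (y - w) →
        0 ≤ (t : ℝ) * (f p - f p') → p = p' := by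
      intro p p' h h0
      have hp' : p' = p + ((t : ℝ) * (f p - f p')) • (y - w) := by
        rw [mul_sub, sub_smul, ← add_sub_assoc, h, add_sub_cancel_right]
      have := key p _ h0 (by rw [← hp'])
      rw [this, zero_smul, add_zero] at hp'
      exact hp'.symm
    intro p p' h
    simp only at h
    rcases le_total 0 ((t : ℝ) * (f p - f p')) with h0 | h0
    · exact key' p p' h h0
    · exact (key' p' p h.symm (by linarith)).symm
  · have : f p = 0 := max_eq_left (by linarith [not_lt.1 fun h => hp ((hmem p).1 h)])
    simp [this]
  · have hp1 := (hmem p).2 hp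
    rw [← hmem]
    have h1 : (t : ℝ) * f p ≤ 1 - gauge S (p - w) := by
      rw [hfU p hp]
      exact mul_le_of_le_one_left (by linarith) t.2.2
    have h2 := hadd p (t * f p) (mul_nonneg t.2.1 (le_max_left _ _))
    simp only
    nlinarith
  · simp [hfU w hw]

/-- Two boundary points of a convex open set are joined by a simple arc through any given point
of the set whose interior lies in the set. -/
theorem exists_arc_through (hUc : Convex ℝ U) (hU : IsOpen U) (hy : y ∈ U) {z z' : E}
    (hz : z ∈ closure U) (hzU : z ∉ U) (hz' : z' ∈ closure U) (hzU' : z' ∉ U) (hne : z ≠ z') :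
    ∃ α : ℝ → E, Continuous α ∧ α 0 = z ∧ α 1 = z' ∧ α 2⁻¹ = y ∧ InjOn α (Icc 0 1) ∧
      ∀ t ∈ Ioo (0 : ℝ) 1, α t ∈ U := by
  set S := (y + ·) ⁻¹' U
  set α : ℝ → E := fun t => y + max 0 (1 - 2 * t) • (z - y) + max 0 (2 * t - 1) • (z' - y) with hα
  have hl : ∀ t, t ≤ 2⁻¹ → α t = y + (1 - 2 * t) • (z - y) := fun t ht => by
    simp only [hα]
    rw [max_eq_right (by linarith), max_eq_left (by linarith), zero_smul, add_zero]
  have hr : ∀ t, 2⁻¹ ≤ t → α t = y + (2 * t - 1) • (z' - y) := fun t ht => by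
    simp only [hα]
    rw [max_eq_left (by linarith), max_eq_right (by linarith), zero_smul, add_zero]
  have hgl : ∀ t, t ≤ 2⁻¹ → gauge S (α t - y) = 1 - 2 * t := fun t ht => by
    rw [hl t ht, add_sub_cancel_left, gauge_smul_of_nonneg (by linarith), smul_eq_mul,
      gauge_sub_eq_one hUc hU hy hz hzU, mul_one]
  have hgr : ∀ t, 2⁻¹ ≤ t → gauge S (α t - y) = 2 * t - 1 := fun t ht => by
    rw [hr t ht, add_sub_cancel_left, gauge_smul_of_nonneg (by linarith), smul_eq_mul,
      gauge_sub_eq_one hUc hU hy hz' hzU', mul_one]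
  have hcross : ∀ t t', t ≤ 2⁻¹ → 2⁻¹ ≤ t' → α t = α t' → t = t' := fun t t' ht ht' h => by
    have hg := hgl t ht
    rw [h, hgr t' ht'] at hg
    rw [hl t ht, hr t' ht', hg] at h
    rcases ht.eq_or_lt with rfl | ht
    · linarith
    · have h2 := smul_right_injective E (by linarith : (1 - 2 * t) ≠ 0) (add_left_cancel h)
      exact absurd (sub_left_injective h2) hne
  refine ⟨α, by fun_prop, ?_, ?_, ?_, fun t _ t' _ h => ?_, fun t ht => ?_⟩
  · rw [hl 0 (by norm_num)]; simp
  · rw [hr 1 (by norm_num)]; norm_num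
  · rw [hl _ le_rfl]; simp
  · rcases le_total t 2⁻¹ with h1 | h1 <;> rcases le_total t' 2⁻¹ with h2 | h2
    · linarith [hgl t h1, hgl t' h2, congrArg (fun p => gauge S (p - y)) h]
    · exact hcross t t' h1 h2 h
    · exact (hcross t' t h2 h1 h.symm).symm
    · linarith [hgr t h1, hgr t' h2, congrArg (fun p => gauge S (p - y)) h]
  · rw [← gauge_sub_lt_one_iff hUc hU hy]
    rcases le_total t 2⁻¹ with h1 | h1
    · rw [hgl t h1]; linarith [ht.1]
    · rw [hgr t h1]; linarith [ht.2]

end gauge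

/-- Around every point there is a maximal free ball. -/
theorem exists_maximal_free_ball {h : ℂ → ℂ} (hc : Continuous h) (hfix : ∀ p, h p ≠ p)
    (x : ℂ) : ∃ R > 0, (∀ p ∈ Metric.ball x R, h p ∉ Metric.ball x R) ∧
      ∃ z, z ∈ Metric.closedBall x R ∧ h z ∈ Metric.closedBall x R := by
  have ht : Tendsto (fun p => max (dist p x) (dist (h p) x)) (cocompact ℂ) atTop :=
    tendsto_atTop_mono (fun p => le_max_left _ _) (tendsto_dist_right_cocompact_atTop x)
  obtain ⟨z, hz⟩ := Continuous.exists_forall_le (by fun_prop) ht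
  refine ⟨max (dist z x) (dist (h z) x), ?_, fun p hp hp' => ?_, z,
    Metric.mem_closedBall.2 (le_max_left _ _), Metric.mem_closedBall.2 (le_max_right _ _)⟩
  · by_contra! h0
    obtain ⟨h1, h2⟩ := max_le_iff.1 h0
    exact hfix z ((dist_le_zero.1 h2).trans (dist_le_zero.1 h1).symm)
  · exact (hz p).not_gt (max_lt hp hp')

/-- A fixed point free homeomorphism of `ℂ` isotopic to the identity has only wandering points. -/
theorem Homeomorph.exists_wandering_nhds (h : ℂ ≃ₜ ℂ) (hiso : InjectivelyIsotopicToId h)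
    (hfix : ∀ p, h p ≠ p) (x : ℂ) :
    ∃ V ∈ 𝓝 x, ∀ n : ℕ, 0 < n → ∀ p ∈ V, h^[n] p ∉ V := by
  obtain ⟨R, hR, hfree, z, hz, hz'⟩ := exists_maximal_free_ball h.continuous hfix x
  set U := Metric.ball x R
  have hU : IsOpen U := Metric.isOpen_ball
  have hUc : Convex ℝ U := convex_ball x R
  rw [← closure_ball x hR.ne'] at hz hz'
  have hfree_closure : ∀ p ∈ U, h p ∉ closure U := fun p hp hcl => by
    have hd : Disjoint (h '' U) U := by
      rw [disjoint_left]
      rintro _ ⟨q, hq, rfl⟩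
      exact hfree q hq
    exact (hd.closure_right (h.isOpenMap U hU)).notMem_of_mem_left (mem_image_of_mem h hp) hcl
  have hfree_preimage : ∀ p ∈ closure U, h p ∉ U := fun p hcl hp => by
    have hd : Disjoint (h ⁻¹' U) U := disjoint_left.2 fun q hq hqU => hfree q hqU hq
    exact (hd.closure_right (hU.preimage h.continuous)).notMem_of_mem_left hp hcl
  have hzU : z ∉ U := fun hzU => hfree_closure z hzU hz'
  have hzU' : h z ∉ U := hfree_preimage z hz
  refine ⟨U, Metric.ball_mem_nhds x hR, ?_⟩
  classical
  by_contra! hret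
  obtain ⟨hN, y, hy, hw⟩ := Nat.find_spec hret
  set N := Nat.find hret
  have hmin : ∀ i, 0 < i → i < N → h^[i] y ∉ U := fun i hi hiN hiU =>
    Nat.find_min hret hiN ⟨hi, y, hy, hiU⟩
  obtain ⟨Φ, hΦ, hΦinj, hΦ0, hΦout, hΦin, hΦw⟩ := exists_isotopy_push hUc hU hw hy
  set g : ℂ → ℂ := fun p => Φ (1, h p) with hg
  have hgU : ∀ p, h p ∉ U → g p = h p := fun p hp => hΦout 1 _ hp
  have hgin : ∀ p, h p ∈ U → g p ∈ U := fun p hp => hΦin 1 _ hp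
  have hgiso : InjectivelyIsotopicToId g := by
    obtain ⟨F, hF, hFinj, hF0, hF1⟩ := hiso
    exact ⟨fun q => Φ (q.1, F q), by fun_prop, fun t => (hΦinj t).comp (hFinj t),
      fun p => by simp [hF0, hΦ0], fun p => by simp [hF1, hg]⟩
  have hgfix : ∀ p, g p ≠ p := fun p hp => by
    by_cases hpU : h p ∈ U
    · exact hfree p (hp ▸ hgin p hpU) hpU
    · exact hfix p ((hgU p hpU).symm.trans hp)
  have hgz : g z = h z := hgU z hzU'
  obtain ⟨α, hα, hα0, hα1, hαy, hαinj, hαU⟩ :=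
    exists_arc_through hUc hU hy hz hzU hz' hzU' (hfix z).symm
  have hgi : ∀ i, i < N → g^[i] y = h^[i] y := fun i => by
    induction i with
    | zero => simp
    | succ i ih =>
      intro hi
      rw [Function.iterate_succ_apply', Function.iterate_succ_apply', ih (by omega), hgU]
      rw [← Function.iterate_succ_apply' h]
      exact hmin _ (by omega) hi
  have hper : g^[N] y = y := by
    obtain ⟨M, hM⟩ := Nat.exists_eq_succ_of_ne_zero hN.ne'
    rw [hM, Function.iterate_succ_apply', hgi M (by omega)]
    simp only [hg]
    rw [← Function.iterate_succ_apply' h, ← hM, hΦw]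
  refine hgiso.false_of_periodic_mem_translation_arc (by fun_prop)
    ((hΦinj 1).comp h.injective) hgfix hα (by rw [hα0, hα1, hgz]) hαinj ?_
    (c := 2⁻¹) ⟨by norm_num, by norm_num⟩ hN (by rw [hαy, hper])
  rintro t ht ⟨t', ht', he⟩
  have hh := hgU _ (hfree _ (hαU t ht))
  rw [hh] at he
  rcases ht'.1.eq_or_lt with rfl | h0
  · exact hfree_closure _ (hαU t ht) (by rw [← he, hα0]; exact hz)
  · rcases ht'.2.eq_or_lt with rfl | h1
    · rw [hα1] at he
      exact hzU (h.injective he ▸ hαU t ht)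
    · exact hfree _ (hαU t ht) (he ▸ hαU t' ⟨h0, h1⟩)

/-- Every point of the plane is wandering for a Brouwer homeomorphism. -/
theorem every_point_wandering (h : BrouwerHomeo) :
    ∀ x : Plane, ∃ V ∈ nhds x, ∀ n : ℤ, n ≠ 0 → Disjoint (h.iter n '' V) V := by
  intro x
  let e : Plane ≃ₜ ℂ := Complex.equivRealProdCLM.symm.toHomeomorph
  let k : ℂ ≃ₜ ℂ := (e.symm.trans h.toHomeomorph).trans e
  have hk : ∀ p, k (e p) = e (h.toHomeomorph p) := fun p => by simp [k]
  have hiso : InjectivelyIsotopicToId k := by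
    obtain ⟨H, hH, hH0, hH1⟩ := h.orientationPreserving
    refine ⟨fun q => e (H q.1 (e.symm q.2)), ?_, fun t => ?_, fun p => ?_, fun p => ?_⟩
    · exact e.continuous.comp (hH.comp (by fun_prop :
        Continuous fun q : I × ℂ => ((q.1 : ℝ), e.symm q.2)))
    · exact e.injective.comp ((H t).injective.comp e.symm.injective)
    · simp [hH0]
    · simp [hH1, k]
  obtain ⟨V, hV, hwand⟩ := k.exists_wandering_nhds hiso
    (fun p hp => h.fixedPointFree (e.symm p) (e.injective (by simpa [k] using hp))) (e x)
  have hiter : ∀ (n : ℕ) p, k^[n] (e p) = e (h.iter n p) := fun n => by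
    induction n with
    | zero => simp [BrouwerHomeo.iter]
    | succ n ih =>
      intro p
      rw [Function.iterate_succ_apply', ih, hk]
      simp only [BrouwerHomeo.iter, Nat.cast_succ, zpow_add_one, zpow_natCast]
      rw [← pow_succ, pow_succ']
      rfl
  refine ⟨e ⁻¹' V, e.continuous.continuousAt hV, fun n hn => ?_⟩
  rw [disjoint_left]
  rintro _ ⟨p, hp, rfl⟩ hq
  obtain ⟨m, rfl | rfl⟩ := n.eq_nat_or_neg
  · exact hwand m (by omega) (e p) hp (by rw [hiter]; exact hq)
  · refine hwand m (by omega) _ hq ?_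
    rw [hiter]
    have : h.iter m (h.iter (-m) p) = p := by
      simp [BrouwerHomeo.iter]
    rwa [this]
end

section
/- Let h be a Brouwer homeomorphism and let γ₁, γ₂ be two free arcs such that the concatenation γ₁ * γ₂ is an arc which is not free. Then exactly one of the following holds: h(γ₁) ∩ γ₂ ≠ ∅, or γ₁ ∩ h(γ₂) ≠ ∅. -/
open Set Filter Topology

/-- A nowhere vanishing difference of two continuous plane-valued maps on a simply connected, locally
path connected space has a continuous complex logarithm. -/
lemma exists_continuous_log_sub {T : Type*} [TopologicalSpace T] [SimplyConnectedSpace T]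
    [LocallyPathConnectedSpace T] {u v : T → Plane} (hu : Continuous u) (hv : Continuous v)
    (huv : ∀ t, u t ≠ v t) :
    ∃ L : T → ℂ, Continuous L ∧
      ∀ t, Complex.exp (L t) = Complex.equivRealProdCLM.symm (u t - v t) := by
  have hne : ∀ t, Complex.equivRealProdCLM.symm (u t - v t) ≠ 0 := fun t => by
    simpa [sub_eq_zero] using huv t
  obtain ⟨t₀⟩ : Nonempty T := inferInstance
  obtain ⟨L, ⟨-, hL⟩, -⟩ := Complex.isCoveringMapOn_exp.existsUnique_continuousMap_lifts
    ⟨fun t => Complex.equivRealProdCLM.symm (u t - v t), by fun_prop⟩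
    (Complex.exp_log (hne t₀)) hne
  exact ⟨L, L.continuous, fun t => congrFun hL t⟩

/-- Two continuous logarithms of proportional functions differ by a constant. -/
lemma sub_eq_sub_of_exp_eq_mul_exp {T : Type*} [TopologicalSpace T] [PreconnectedSpace T]
    {L M : T → ℂ} (hL : Continuous L) (hM : Continuous M) (k : ℂ)
    (h : ∀ t, Complex.exp (L t) = k * Complex.exp (M t)) (x y : T) :
    L x - L y = M x - M y := by
  obtain ⟨l, hl⟩ : ∃ l, Complex.exp l = k := by
    refine ⟨Complex.log k, Complex.exp_log fun hk => ?_⟩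
    simpa [hk] using h x
  have hmem : ∀ t, ∃ n : ℤ, L t - M t = l + n * (2 * Real.pi * Complex.I) := fun t => by
    obtain ⟨n, hn⟩ := Complex.exp_eq_exp_iff_exists_int.1
      (show Complex.exp (L t) = Complex.exp (l + M t) by rw [h t, Complex.exp_add, hl])
    exact ⟨n, by rw [hn]; ring⟩
  choose n hn using hmem
  have hcont : Continuous fun t => (n t : ℝ) := by
    have : (fun t => (n t : ℝ)) =
        fun t => ((L t - M t - l) / (2 * Real.pi * Complex.I)).re := by
      funext t
      rw [hn t, add_sub_cancel_left, mul_div_cancel_right₀ _ Complex.two_pi_I_ne_zero]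
      simp
    rw [this]
    fun_prop
  have hn_cont : Continuous n := Int.isClosedEmbedding_coe_real.isInducing.continuous_iff.2 hcont
  have hnxy : n x = n y := PreconnectedSpace.constant ‹_› hn_cont
  linear_combination hn x - hn y + (2 * Real.pi * Complex.I) * congrArg (Int.cast : ℤ → ℂ) hnxy

/-- Two disjoint free paths `X`, `Y` cannot satisfy both `h(Y) ∩ X ≠ ∅` and `h(X) ∩ Y ≠ ∅`:
the angles of `h p - p` and of `X x - Y y` would fail to match. -/
lemma not_two_crossings (h : BrouwerHomeo) {X Y : ℝ → Plane} (hX : Continuous X)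
    (hY : Continuous Y) (hXX : ∀ x x', h.toHomeomorph (X x) ≠ X x')
    (hYY : ∀ y y', h.toHomeomorph (Y y) ≠ Y y') (hXY : ∀ x y, X x ≠ Y y) {a b c d : ℝ}
    (hab : h.toHomeomorph (Y a) = X b) (hdc : h.toHomeomorph (X d) = Y c) : False := by
  obtain ⟨H, hH, hH0, hH1⟩ := h.orientationPreserving
  set e := Complex.equivRealProdCLM.symm
  have hh : Continuous h.toHomeomorph := h.toHomeomorph.continuous
  have hH0' : ∀ p, H 0 p = p := fun p => by rw [hH0]; rfl
  have hH1' : ∀ p, H 1 p = h.toHomeomorph p := fun p => by rw [hH1]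
  have hHc : ∀ {T : Type} [TopologicalSpace T] {τ : T → ℝ} {u : T → Plane},
      Continuous τ → Continuous u → Continuous fun t => H (τ t) (u t) :=
    fun hτ hu => hH.comp (hτ.prodMk hu)
  -- `W` measures the angle of `h p - p`, `S` that of `X x - Y y`, both along the isotopy.
  obtain ⟨W, hW, hWe⟩ := exists_continuous_log_sub (T := ℝ × Plane)
    (u := fun q => H q.1 (h.toHomeomorph q.2)) (v := fun q => H q.1 q.2)
    (hHc (by fun_prop) (by fun_prop)) (hHc (by fun_prop) (by fun_prop))
    (fun q hq => h.fixedPointFree q.2 ((H q.1).injective hq))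
  obtain ⟨S, hS, hSe⟩ := exists_continuous_log_sub (T := ℝ × ℝ × ℝ)
    (u := fun q => H q.1 (X q.2.1)) (v := fun q => H q.1 (Y q.2.2))
    (hHc (by fun_prop) (by fun_prop)) (hHc (by fun_prop) (by fun_prop))
    (fun q hq => hXY _ _ ((H q.1).injective hq))
  obtain ⟨P, hP, hPe⟩ := exists_continuous_log_sub (T := ℝ × ℝ)
    (u := fun q => h.toHomeomorph (X q.1)) (v := fun q => X q.2)
    (by fun_prop) (by fun_prop) (fun q => hXX _ _)
  obtain ⟨Q, hQ, hQe⟩ := exists_continuous_log_sub (T := ℝ × ℝ)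
    (u := fun q => h.toHomeomorph (Y q.1)) (v := fun q => Y q.2)
    (by fun_prop) (by fun_prop) (fun q => hYY _ _)
  have hneg : ∀ p q : Plane, e (p - q) = -1 * e (q - p) := fun p q => by
    rw [← neg_sub q p, map_neg]; ring
  have hW1 := sub_eq_sub_of_exp_eq_mul_exp (L := fun p => W (1, p))
    (M := fun p => W (0, h.toHomeomorph p)) (by fun_prop) (by fun_prop) 1
    (fun p => by simp only [hWe, hH0', hH1', one_mul]) (X d) (Y a)
  have hWP := sub_eq_sub_of_exp_eq_mul_exp (L := fun x => W (0, X x)) (M := fun x => P (x, x))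
    (by fun_prop) (by fun_prop) 1 (fun p => by simp only [hWe, hPe, hH0', one_mul]) d b
  have hWQ := sub_eq_sub_of_exp_eq_mul_exp (L := fun y => W (0, Y y)) (M := fun y => Q (y, y))
    (by fun_prop) (by fun_prop) 1 (fun p => by simp only [hWe, hQe, hH0', one_mul]) c a
  have hS1P := sub_eq_sub_of_exp_eq_mul_exp (L := fun x => S (1, x, a)) (M := fun x => P (x, b))
    (by fun_prop) (by fun_prop) 1 (fun p => by simp only [hSe, hPe, hH1', hab, one_mul]) d b
  have hS1Q := sub_eq_sub_of_exp_eq_mul_exp (L := fun y => S (1, d, y)) (M := fun y => Q (y, c))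
    (by fun_prop) (by fun_prop) (-1)
    (fun p => by simp only [hSe, hQe, hH1', hdc]; exact hneg _ _) c a
  have hS0P := sub_eq_sub_of_exp_eq_mul_exp (L := fun x => S (0, x, c)) (M := fun x => P (d, x))
    (by fun_prop) (by fun_prop) (-1)
    (fun p => by simp only [hSe, hPe, hH0', hdc]; exact hneg _ _) d b
  have hS0Q := sub_eq_sub_of_exp_eq_mul_exp (L := fun y => S (0, b, y)) (M := fun y => Q (a, y))
    (by fun_prop) (by fun_prop) 1 (fun p => by simp only [hSe, hQe, hH0', hab, one_mul]) c a
  have hWSa := sub_eq_sub_of_exp_eq_mul_exp (L := fun τ => W (τ, Y a))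
    (M := fun τ => S (τ, b, a)) (by fun_prop) (by fun_prop) 1
    (fun p => by simp only [hWe, hSe, hab, one_mul]) 1 0
  have hWSd := sub_eq_sub_of_exp_eq_mul_exp (L := fun τ => W (τ, X d))
    (M := fun τ => S (τ, d, c)) (by fun_prop) (by fun_prop) (-1)
    (fun p => by simp only [hWe, hSe, hdc]; exact hneg _ _) 1 0
  simp only [hab, hdc] at hW1 hWP hWQ hS1P hS1Q hS0P hS0Q hWSa hWSd
  have hzero : W (0, X d) - S (0, d, c) = W (0, Y a) - S (0, b, a) := by
    linear_combination (1 / 2 : ℂ) *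
      (hW1 + hWP + hWQ - hS1P - hS1Q - hS0P - hS0Q + hWSa - hWSd)
  have hd : Complex.exp (W (0, X d) - S (0, d, c)) = -1 := by
    have hne := Complex.exp_ne_zero (S (0, d, c))
    rw [Complex.exp_sub, div_eq_iff hne, hWe, hSe]
    simp only [hH0', hdc]
    exact hneg _ _
  have ha : Complex.exp (W (0, Y a) - S (0, b, a)) = 1 := by
    have hne := Complex.exp_ne_zero (S (0, b, a))
    rw [Complex.exp_sub, div_eq_iff hne, hWe, hSe, one_mul]
    simp only [hH0', hab]
  rw [hzero, ha] at hd
  norm_num at hd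

/-- If `γ₁ = f([0,s])` and `γ₂ = f([s,1])` are free arcs whose
concatenation (the arc `f([0,1])`) is not free, then exactly one of
`h(γ₁) ∩ γ₂ ≠ ∅` and `γ₁ ∩ h(γ₂) ≠ ∅` holds. -/
theorem exactly_one_crossing (h : BrouwerHomeo)
    (f : unitInterval → Plane) (s : unitInterval)
    (hf : Continuous f) (hinj : Function.Injective f)
    (h1 : IsFree h (f '' Set.Icc 0 s)) (h2 : IsFree h (f '' Set.Icc s 1))
    (hnot : ¬ IsFree h (Set.range f)) :
    Xor' (h.toHomeomorph '' (f '' Set.Icc 0 s) ∩ f '' Set.Icc s 1).Nonempty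
         (f '' Set.Icc 0 s ∩ h.toHomeomorph '' (f '' Set.Icc s 1)).Nonempty := by
  have hfree1 : ∀ x ≤ s, ∀ y ≤ s, h.toHomeomorph (f x) ≠ f y := fun x hx y hy hxy =>
    disjoint_left.1 h1 (mem_image_of_mem _ (mem_image_of_mem f ⟨bot_le, hx⟩))
      (hxy ▸ mem_image_of_mem f ⟨bot_le, hy⟩)
  have hfree2 : ∀ x ≥ s, ∀ y ≥ s, h.toHomeomorph (f x) ≠ f y := fun x hx y hy hxy =>
    disjoint_left.1 h2 (mem_image_of_mem _ (mem_image_of_mem f ⟨hx, le_top⟩))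
      (hxy ▸ mem_image_of_mem f ⟨hy, le_top⟩)
  refine (xor_iff_or_and_not_and _ _).2 ?_
  constructor
  · obtain ⟨-, ⟨-, ⟨x, rfl⟩, rfl⟩, y, hy⟩ := not_disjoint_iff.1 hnot
    rcases le_total x s with hx | hx <;> rcases le_total y s with hy' | hy'
    · exact absurd hy.symm (hfree1 x hx y hy')
    · exact .inl ⟨_, ⟨_, ⟨x, ⟨bot_le, hx⟩, rfl⟩, rfl⟩, y, ⟨hy', le_top⟩, hy⟩
    · exact .inr ⟨_, ⟨y, ⟨bot_le, hy'⟩, hy⟩, _, ⟨x, ⟨hx, le_top⟩, rfl⟩, rfl⟩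
    · exact absurd hy.symm (hfree2 x hx y hy')
  · rintro ⟨⟨-, ⟨-, ⟨a, ⟨-, ha⟩, rfl⟩, rfl⟩, b, ⟨hb, -⟩, hab⟩,
      -, ⟨c, ⟨-, hc⟩, rfl⟩, -, ⟨d, ⟨hd, -⟩, rfl⟩, hdc⟩
    have ha' : a < s := lt_of_le_of_ne ha fun has => hfree2 a has.ge b hb hab.symm
    have hb' : s < b := lt_of_le_of_ne hb fun hsb => hfree1 a ha b hsb.ge hab.symm
    have hc' : c < s := lt_of_le_of_ne hc fun hcs => hfree2 d hd c hcs.ge hdc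
    have hd' : s < d := lt_of_le_of_ne hd fun hsd => hfree1 d hsd.ge c hc hdc
    have hm : s < min b d := lt_min hb' hd'
    have hn : max a c < s := max_lt ha' hc'
    have hproj : ∀ x : unitInterval, projIcc (0 : ℝ) 1 zero_le_one x = x :=
      fun x => projIcc_val zero_le_one x
    refine not_two_crossings h
      (X := fun x => f (max (min b d) (projIcc (0 : ℝ) 1 zero_le_one x)))
      (Y := fun y => f (min (max a c) (projIcc (0 : ℝ) 1 zero_le_one y)))
      (by fun_prop) (by fun_prop)
      (fun x x' => hfree2 _ (hm.le.trans (le_max_left _ _)) _ (hm.le.trans (le_max_left _ _)))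
      (fun y y' => hfree1 _ ((min_le_left _ _).trans hn.le) _ ((min_le_left _ _).trans hn.le))
      (fun x y hxy => ((min_le_left _ _).trans_lt (hn.trans hm)).not_ge
        ((le_max_left _ _).trans_eq (hinj hxy)))
      (a := a) (b := b) (c := c) (d := d) ?_ ?_
    · simpa [hproj] using hab.symm
    · simpa [hproj] using hdc
end
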